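/- For every natural number n, if n is odd and n is not congruent to 1 modulo 3, then (n+2)! * n! divides (2n)! (equivalently, the quantity (2n)!/((n+2)! * n!) is an integer). -/

import Mathlib

theorem add_two_mul_catalan_succ (n : ℕ) :
    (n + 2) * catalan (n + 1) = 2 * (2 * n + 1) * catalan n := by
  have h := Nat.succ_mul_centralBinom_succ n
  rw [← succ_mul_catalan_eq_centralBinom, ← succ_mul_catalan_eq_centralBinom] at h
  apply Nat.eq_of_mul_eq_mul_left (show 0 < n + 1 by omega)
  linear_combination h

theorem coprime_add_two_two_mul {n : ℕ} (h1 : Odd n) (h2 : n % 3 ≠ 1) :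
    Nat.Coprime (n + 2) (2 * (2 * n + 1)) := by
  refine Nat.Coprime.mul_right ?_ ?_
  · rw [Nat.coprime_two_right]
    exact h1.add_even even_two
  · have h3 : Nat.Coprime (n + 2) 3 := by
      rw [Nat.coprime_comm, Nat.Prime.coprime_iff_not_dvd Nat.prime_three]
      omega
    refine Nat.Coprime.coprime_dvd_left (Nat.gcd_dvd_left _ _) h3 |>.eq_one_of_dvd ?_
    have h4 : 2 * (n + 2) - (2 * n + 1) = 3 := by omega
    rw [← h4]
    exact Nat.dvd_sub ((Nat.gcd_dvd_left _ _).mul_left 2) (Nat.gcd_dvd_right _ _)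

theorem factorial_div (n : ℕ) (h1 : Odd n) (h2 : n % 3 ≠ 1) :
    Nat.factorial (n + 2) * Nat.factorial n ∣ Nat.factorial (2 * n) := by
  obtain ⟨k, hk⟩ : n + 2 ∣ catalan n :=
    (coprime_add_two_two_mul h1 h2).dvd_of_dvd_mul_left
      ⟨_, (add_two_mul_catalan_succ n).symm⟩
  have hc := Nat.choose_mul_factorial_mul_factorial (show n ≤ 2 * n by omega)
  rw [← Nat.centralBinom_eq_two_mul_choose, ← succ_mul_catalan_eq_centralBinom, hk,
    show 2 * n - n = n by omega] at hc
  refine ⟨k, ?_⟩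
  rw [← hc, Nat.factorial_succ (n + 1), Nat.factorial_succ n]
  ring
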